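/- Let λ > 0, μ ≠ 0 and c be real numbers, let f : ℝ → ℝ be twice differentiable with f''(u) + 2·f(u)³ = 0 for all u, let p₀ ∈ ℝ and q ∈ ℝ⁴ satisfy p₀² − |q|² = μ²·√(λ/2), where |q|² is the Euclidean norm squared. Then φ : ℝ × ℝ⁴ → ℝ defined by φ(τ, x) = μ·(2/λ)^{1/4}·f(p₀·τ + q·x + c) satisfies ∂_τ² φ − Δ₂ φ + λ·φ³ = 0, where Δ₂ = Σ_{i=1}^{4} ∂_i² is the Laplacian in the four Euclidean variables x. -/

import Mathlib

/-- Partial derivative along the `i`-th coordinate of a function on Euclidean ℝ⁴. -/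
noncomputable def pd (i : Fin 4) (f : (Fin 4 → ℝ) → ℝ) (x : Fin 4 → ℝ) : ℝ :=
  fderiv ℝ f x (Pi.single i 1)

/-- The Laplacian `Δ₂ = Σ_{i=1}^4 ∂_i²` in the four Euclidean variables. -/
noncomputable def lap2 (f : (Fin 4 → ℝ) → ℝ) (x : Fin 4 → ℝ) : ℝ :=
  ∑ i, pd i (pd i f) x

theorem pd_wave (i : Fin 4) (A b c : ℝ) (q : Fin 4 → ℝ) (g : ℝ → ℝ) (hg : Differentiable ℝ g) :
    pd i (fun x => A * g (b + (∑ j, q j * x j) + c)) =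
      fun x => (A * q i) * deriv g (b + (∑ j, q j * x j) + c) := by
  funext x
  unfold pd
  have hL : HasFDerivAt (fun x : Fin 4 → ℝ => b + (∑ j, q j * x j) + c)
      (∑ j, q j • (ContinuousLinearMap.proj j : (Fin 4 → ℝ) →L[ℝ] ℝ)) x := by
    apply HasFDerivAt.add_const
    apply HasFDerivAt.const_add
    apply HasFDerivAt.fun_sum
    intro j _
    exact (hasFDerivAt_apply j x).const_mul (q j)
  have h := (((hg _).hasDerivAt).comp_hasFDerivAt x hL).const_mul A
  have h2 := h.fderiv
  simp only [Function.comp_def] at h2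
  rw [h2]
  simp [Pi.single_apply]
  ring

theorem dt_wave (A p s c : ℝ) (g : ℝ → ℝ) (hg : Differentiable ℝ g) :
    deriv (fun t => A * g (p * t + s + c)) = fun t => (A * p) * deriv g (p * t + s + c) := by
  funext t
  have hL : HasDerivAt (fun t : ℝ => p * t + s + c) (p * 1) t :=
    (((hasDerivAt_id t).const_mul p).add_const s).add_const c
  have h := (((hg _).hasDerivAt).comp t hL).const_mul A
  have h2 := h.deriv
  simp only [Function.comp_def] at h2
  rw [h2]
  ring

/-- the snoidal travelling wave
`φ(τ, x) = μ (2/λ)^{1/4} f(p₀ τ + q·x + c)`, with `f'' + 2f³ = 0` and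
`p₀² − |q|² = μ² √(λ/2)` (Euclidean norm), solves the five-dimensional equation
`∂_τ² φ − Δ₂ φ + λ φ³ = 0`, where `Δ₂ = Σ_{i=1}^4 ∂_i²`. -/
theorem snoidal_wave_solves_fiveDim_quartic_scalar
    (lam μ c : ℝ) (hlam : 0 < lam) (hμ : μ ≠ 0)
    (f : ℝ → ℝ) (hf : Differentiable ℝ f) (hf' : Differentiable ℝ (deriv f))
    (hode : ∀ u : ℝ, deriv (deriv f) u + 2 * (f u) ^ 3 = 0)
    (p₀ : ℝ) (q : Fin 4 → ℝ)
    (hdisp : p₀ ^ 2 - ∑ i, (q i) ^ 2 = μ ^ 2 * Real.sqrt (lam / 2))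
    (φ : ℝ → (Fin 4 → ℝ) → ℝ)
    (hφ : ∀ (τ : ℝ) (x : Fin 4 → ℝ),
      φ τ x = μ * (2 / lam) ^ ((1 : ℝ) / 4) * f (p₀ * τ + (∑ i, q i * x i) + c)) :
    ∀ (τ : ℝ) (x : Fin 4 → ℝ),
      deriv (deriv (fun t => φ t x)) τ - lap2 (φ τ) x + lam * (φ τ x) ^ 3 = 0 := by
  intro τ x
  set k : ℝ := (2 / lam) ^ ((1 : ℝ) / 4) with hk
  have e1 : (fun t => φ t x) = fun t => (μ * k) * f (p₀ * t + (∑ i, q i * x i) + c) :=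
    funext fun t => hφ t x
  have e2 : φ τ = fun x => (μ * k) * f (p₀ * τ + (∑ i, q i * x i) + c) := funext (hφ τ)
  have e3 : lap2 (φ τ) x = (∑ i, (q i) ^ 2) *
      ((μ * k) * deriv (deriv f) (p₀ * τ + (∑ i, q i * x i) + c)) := by
    unfold lap2
    rw [e2, Finset.sum_mul]
    refine Finset.sum_congr rfl fun i _ => ?_
    rw [pd_wave i _ _ _ _ _ hf, pd_wave i _ _ _ _ _ hf']
    ring
  rw [e3, e1, dt_wave _ _ _ _ _ hf, dt_wave _ _ _ _ _ hf', hφ]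
  beta_reduce
  have ho := hode (p₀ * τ + (∑ i, q i * x i) + c)
  generalize p₀ * τ + (∑ i, q i * x i) + c = u at *
  have hs : 0 < Real.sqrt (lam / 2) := Real.sqrt_pos.mpr (by positivity)
  have hs2 : Real.sqrt (lam / 2) ^ 2 = lam / 2 := Real.sq_sqrt (by positivity)
  have hk2 : k ^ 2 = (Real.sqrt (lam / 2))⁻¹ := by
    rw [hk, ← Real.sqrt_inv, inv_div, Real.sqrt_eq_rpow, ← Real.rpow_natCast,
      ← Real.rpow_mul (by positivity)]
    norm_num
  have hlk : lam * k ^ 2 = 2 * Real.sqrt (lam / 2) := by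
    rw [hk2]
    field_simp
    linarith
  have hd : deriv (deriv f) u = -2 * f u ^ 3 := by linarith
  rw [hd]
  linear_combination (-2 * μ * k * f u ^ 3) * hdisp + (μ ^ 3 * k * f u ^ 3) * hlk
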